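/- For all integers k ≥ 1 and all integers p with 0 ≤ p ≤ k, the identity Ê_p^k = Ē_p^k + q_k·(1 − x_k)·Ē_{p−1}^{k−1} holds in ℤ[q_1, q_2, …, x_1, x_2, …]. -/

import Mathlib

open MvPolynomial Finset

noncomputable section

/-- The polynomial ring `ℤ[q_1, q_2, …, x_1, x_2, …]`; the variable `Sum.inl i` is `q_i`
and `Sum.inr i` is `x_i`. -/
abbrev P : Type := MvPolynomial (ℕ ⊕ ℕ) ℤ

/-- The variable `q_i`. -/
def qv (i : ℕ) : P := X (Sum.inl i)

/-- The variable `x_i`. -/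
def xv (i : ℕ) : P := X (Sum.inr i)

/-- The polynomial `F_p^k`, defined as `0` unless `0 ≤ p ≤ k`. -/
def Fp (p k : ℤ) : P :=
  if 0 ≤ p ∧ p ≤ k then
    ∑ I ∈ (Finset.Icc 1 k.toNat).powersetCard p.toNat,
      (∏ i ∈ I, (1 - xv i)) * ∏ i ∈ I.filter (fun i => i + 1 ∉ I), (1 - qv i)
  else 0

/-- The substitution `q_k ↦ 0`. -/
def setQ (k : ℕ) : P →ₐ[ℤ] P :=
  aeval (fun v => if v = Sum.inl k then 0 else X v)

/-- The polynomial `Ê_p^k = Σ_{i=0}^p (−1)^i C(k−i, p−i) F_i^k`, defined as `0` unless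
`0 ≤ p ≤ k`. -/
def Ehat (p k : ℤ) : P :=
  if 0 ≤ p ∧ p ≤ k then
    ∑ i ∈ Finset.range (p.toNat + 1),
      (-1 : P) ^ i * (Nat.choose (k.toNat - i) (p.toNat - i) : P) * Fp (i : ℤ) k
  else 0

/-- `Ē_p^k`, i.e. `Ê_p^k` with `q_k` set to `0`. -/
def Ebar (p k : ℤ) : P := setQ k.toNat (Ehat p k)

/-- The summand of `F_p^k` indexed by `I`. -/
def weight (I : Finset ℕ) : P :=
  (∏ i ∈ I, (1 - xv i)) * ∏ i ∈ I.filter (fun i => i + 1 ∉ I), (1 - qv i)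

theorem setQ_xv (k i : ℕ) : setQ k (xv i) = xv i := by
  simp [setQ, xv]

theorem setQ_qv (k i : ℕ) : setQ k (qv i) = if i = k then 0 else qv i := by
  simp [setQ, qv]

theorem setQ_comm (k l : ℕ) (f : P) : setQ k (setQ l f) = setQ l (setQ k f) := by
  suffices h : (setQ k).comp (setQ l) = (setQ l).comp (setQ k) from DFunLike.congr_fun h f
  refine MvPolynomial.algHom_ext fun v => ?_
  rcases v with i | i
  · change setQ k (setQ l (qv i)) = setQ l (setQ k (qv i))
    rw [setQ_qv, setQ_qv]
    split_ifs with h₁ h₂ h₂ <;> simp [setQ_qv, h₁, h₂]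
  · change setQ k (setQ l (xv i)) = setQ l (setQ k (xv i))
    simp only [setQ_xv]

theorem setQ_weight (k : ℕ) (I : Finset ℕ) :
    setQ k (weight I) = (∏ i ∈ I, (1 - xv i)) *
      ∏ i ∈ (I.filter (fun i => i + 1 ∉ I)).erase k, (1 - qv i) := by
  simp only [weight, map_mul, map_prod, map_sub, map_one, setQ_xv, setQ_qv]
  congr 1
  rw [← Finset.prod_erase (a := k) _ (by simp)]
  refine Finset.prod_congr rfl fun i hi => ?_
  rw [if_neg (Finset.ne_of_mem_erase hi)]

theorem setQ_weight_of_notMem {k : ℕ} {I : Finset ℕ} (h : k ∉ I) :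
    setQ k (weight I) = weight I := by
  rw [setQ_weight, Finset.erase_eq_of_notMem (by simp [h]), weight]

theorem weight_insert {n : ℕ} {J : Finset ℕ} (hJ : J ⊆ Finset.Icc 1 n) :
    weight (insert (n + 1) J) = (1 - xv (n + 1)) * (1 - qv (n + 1)) * setQ n (weight J) := by
  have hlt : ∀ i ∈ J, i ≤ n := fun i hi => (Finset.mem_Icc.mp (hJ hi)).2
  have hn : n + 1 ∉ J := fun h => by have := hlt _ h; omega
  have hfilter : (insert (n + 1) J).filter (fun i => i + 1 ∉ insert (n + 1) J) =
      insert (n + 1) ((J.filter (fun i => i + 1 ∉ J)).erase n) := by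
    ext i
    simp only [Finset.mem_filter, Finset.mem_insert, Finset.mem_erase]
    have := hlt i
    have := hlt (i + 1)
    grind
  rw [weight, hfilter, Finset.prod_insert hn, Finset.prod_insert (by simp [hn]), setQ_weight]
  ring

theorem weight_insert_sub_setQ {n : ℕ} {J : Finset ℕ} (hJ : J ⊆ Finset.Icc 1 n) :
    weight (insert (n + 1) J) - setQ (n + 1) (weight (insert (n + 1) J)) =
      -(qv (n + 1) * (1 - xv (n + 1))) * setQ n (weight J) := by
  have hn : n + 1 ∉ J := fun h => by have := Finset.mem_Icc.mp (hJ h); omega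
  rw [weight_insert hJ]
  simp only [map_mul, map_sub, map_one, setQ_xv, setQ_qv, if_true]
  rw [setQ_comm, setQ_weight_of_notMem hn]
  ring

theorem Fp_natCast (p k : ℕ) :
    Fp p k = ∑ I ∈ (Finset.Icc 1 k).powersetCard p, weight I := by
  rw [Fp]
  split_ifs with h
  · rfl
  · rw [Finset.powersetCard_eq_empty.mpr (by rw [Nat.card_Icc]; omega), Finset.sum_empty]

theorem Fp_zero_left (k : ℕ) : Fp 0 k = 1 := by
  simpa [weight] using Fp_natCast 0 k

theorem Fp_succ_sub_setQ (p n : ℕ) :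
    Fp (p + 1 : ℕ) (n + 1 : ℕ) - setQ (n + 1) (Fp (p + 1 : ℕ) (n + 1 : ℕ)) =
      -(qv (n + 1) * (1 - xv (n + 1))) * setQ n (Fp p n) := by
  have hn : n + 1 ∉ Finset.Icc 1 n := by simp
  have hIcc : Finset.Icc 1 (n + 1) = insert (n + 1) (Finset.Icc 1 n) := by
    ext i
    simp only [Finset.mem_Icc, Finset.mem_insert]
    omega
  have hnot : ∀ {m : ℕ}, ∀ J ∈ (Finset.Icc 1 n).powersetCard m, n + 1 ∉ J :=
    fun J hJ h => hn ((Finset.mem_powersetCard.mp hJ).1 h)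
  rw [Fp_natCast, Fp_natCast, map_sum, map_sum, ← Finset.sum_sub_distrib, hIcc,
    Finset.powersetCard_succ_insert hn, Finset.sum_union, Finset.sum_image, Finset.mul_sum]
  · rw [Finset.sum_eq_zero fun J hJ => by rw [setQ_weight_of_notMem (hnot J hJ), sub_self],
      zero_add]
    exact Finset.sum_congr rfl fun J hJ =>
      weight_insert_sub_setQ (Finset.mem_powersetCard.mp hJ).1
  · intro I hI J hJ h
    rw [← Finset.erase_insert (hnot I hI), h, Finset.erase_insert (hnot J hJ)]
  · rw [Finset.disjoint_left]
    intro I hI hI'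
    obtain ⟨J, -, rfl⟩ := Finset.mem_image.mp hI'
    exact hnot _ hI (Finset.mem_insert_self _ _)

theorem Ehat_natCast {p k : ℕ} (h : p ≤ k) :
    Ehat p k = ∑ i ∈ Finset.range (p + 1),
      (-1 : P) ^ i * (Nat.choose (k - i) (p - i) : P) * Fp (i : ℤ) k := by
  rw [Ehat, if_pos (by omega)]
  rfl

theorem Ehat_sub_setQ {p k : ℕ} (h : p ≤ k) (m : ℕ) :
    Ehat p k - setQ m (Ehat p k) = ∑ i ∈ Finset.range (p + 1),
      (-1 : P) ^ i * (Nat.choose (k - i) (p - i) : P) * (Fp (i : ℤ) k - setQ m (Fp (i : ℤ) k)) := by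
  simp only [Ehat_natCast h, map_sum, map_mul, map_pow, map_neg, map_one, map_natCast, mul_sub,
    Finset.sum_sub_distrib]

/-- For all integers `k ≥ 1` and `0 ≤ p ≤ k`,
`Ê_p^k = Ē_p^k + q_k·(1 − x_k)·Ē_{p−1}^{k−1}`. -/
theorem statement4 (k p : ℤ) (hk : 1 ≤ k) (hp : 0 ≤ p) (hpk : p ≤ k) :
    Ehat p k = Ebar p k + qv k.toNat * (1 - xv k.toNat) * Ebar (p - 1) (k - 1) := by
  lift p to ℕ using hp
  lift k to ℕ using by omega
  obtain ⟨n, rfl⟩ : ∃ n, k = n + 1 := ⟨k - 1, by omega⟩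
  rw [← sub_eq_iff_eq_add', Ebar, Ebar, Int.toNat_natCast, Ehat_sub_setQ (by omega),
    Finset.sum_range_succ', Nat.cast_zero, Fp_zero_left, map_one, sub_self, mul_zero, add_zero]
  rcases p with _ | p
  · simp [Ehat]
  · rw [show ((p + 1 : ℕ) : ℤ) - 1 = (p : ℕ) by omega,
      show ((n + 1 : ℕ) : ℤ) - 1 = (n : ℕ) by omega, Int.toNat_natCast,
      Ehat_natCast (by omega), map_sum, Finset.mul_sum]
    refine Finset.sum_congr rfl fun i _ => ?_
    rw [Fp_succ_sub_setQ, Nat.add_sub_add_right, Nat.add_sub_add_right]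
    simp only [map_mul, map_pow, map_neg, map_one, map_natCast]
    ring
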